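/- Let ε be a real random variable with E|ε|^{p₀−1} < ∞ for some p₀ ∈ (1,2], let τ ∈ (0,1), and define Q^{lp}(s) = E[η_{τ,p}(ε − s) − η_{τ,p}(ε)] and Q(s) = E[η_{τ,1}(ε − s) − η_{τ,1}(ε)]. Then for every s ∈ ℝ, Q^{lp}(s) → Q(s) as p → 1+, and moreover for every compact set B ⊂ ℝ, sup_{s∈B} |Q^{lp}(s) − Q(s)| → 0 as p → 1+. -/

import Mathlib

open MeasureTheory ProbabilityTheory Filter Finset Real

/-- L^p-quantile loss η_{τ,p}(s) = |τ − 1_{s<0}|·|s|^p. -/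
noncomputable def etaLp (τ p s : ℝ) : ℝ := |τ - (if s < 0 then (1 : ℝ) else 0)| * |s| ^ p

/-- φ_{τ,p}(s) = p·|τ − 1_{s<0}|·|s|^{p−1}·sign(s). -/
noncomputable def phiLp (τ p s : ℝ) : ℝ :=
  p * |τ - (if s < 0 then (1 : ℝ) else 0)| * |s| ^ (p - 1) * Real.sign s

/-- ψ_{τ,p}(s) = p(p−1)·|τ − 1_{s<0}|·|s|^{p−2}. -/
noncomputable def psiLp (τ p s : ℝ) : ℝ :=
  p * (p - 1) * |τ - (if s < 0 then (1 : ℝ) else 0)| * |s| ^ (p - 2)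

/-- γ is the centered Gaussian law on `n → ℝ` with covariance matrix `S`:
every linear functional pushes γ to the one-dimensional centered Gaussian with the
corresponding variance. -/
def IsCenteredGaussianCov {n : Type*} [Fintype n] (γ : Measure (n → ℝ))
    (S : Matrix n n ℝ) : Prop :=
  ∀ l : n → ℝ, γ.map (fun v => ∑ i, l i * v i) =
    gaussianReal 0 (Real.toNNReal (∑ i, ∑ j, l i * S i j * l j))

theorem etaLp_eq_posPart_add_negPart {τ p : ℝ} (hτ : τ ∈ Set.Ioo (0 : ℝ) 1) (hp : p ≠ 0) (x : ℝ) :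
    etaLp τ p x = τ * (max x 0) ^ p + (1 - τ) * (max (-x) 0) ^ p := by
  obtain ⟨h0, h1⟩ := hτ
  unfold etaLp
  rcases lt_or_ge x 0 with hx | hx
  · rw [if_pos hx, abs_of_neg hx, abs_of_neg (by linarith : τ - 1 < 0), max_eq_right hx.le,
      max_eq_left (by linarith), Real.zero_rpow hp]
    ring
  · rw [if_neg hx.not_gt, abs_of_nonneg hx, sub_zero, abs_of_pos h0, max_eq_left hx,
      max_eq_right (by linarith), Real.zero_rpow hp]
    ring

theorem tendsto_etaLp {τ p : ℝ} (hτ : τ ∈ Set.Ioo (0 : ℝ) 1) (hp : 0 < p) (x : ℝ) :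
    Tendsto (fun z : ℝ × ℝ => etaLp τ z.1 z.2) (nhds (p, x)) (nhds (etaLp τ p x)) := by
  have hne : ∀ᶠ z : ℝ × ℝ in nhds (p, x), z.1 ≠ 0 :=
    continuousAt_fst.eventually_ne hp.ne'
  rw [etaLp_eq_posPart_add_negPart hτ hp.ne']
  have key : ContinuousAt
      (fun z : ℝ × ℝ => τ * (max z.2 0) ^ z.1 + (1 - τ) * (max (-z.2) 0) ^ z.1) (p, x) := by
    refine (continuousAt_const.mul (ContinuousAt.rpow ?_ continuousAt_fst (Or.inr hp))).add
      (continuousAt_const.mul (ContinuousAt.rpow ?_ continuousAt_fst (Or.inr hp))) <;> fun_prop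
  refine Tendsto.congr' ?_ key
  filter_upwards [hne] with z hz using (etaLp_eq_posPart_add_negPart hτ hz z.2).symm

theorem tendsto_etaLp_comp {τ p : ℝ} (hτ : τ ∈ Set.Ioo (0 : ℝ) 1) (hp : 0 < p) {f : ℝ → ℝ}
    (hf : Continuous f) (s : ℝ) :
    Tendsto (fun z : ℝ × ℝ => etaLp τ z.1 (f z.2)) (nhds (p, s)) (nhds (etaLp τ p (f s))) := by
  have hpair : Tendsto (fun z : ℝ × ℝ => (z.1, f z.2)) (nhds (p, s)) (nhds (p, f s)) :=
    (continuous_fst.prodMk (hf.comp continuous_snd)).tendsto' _ _ rfl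
  simpa only [Function.comp_def] using (tendsto_etaLp hτ hp (f s)).comp hpair

theorem measurable_etaLp (τ p : ℝ) : Measurable (etaLp τ p) := by
  unfold etaLp
  have h : Measurable fun s : ℝ => if s < 0 then (1 : ℝ) else 0 :=
    Measurable.ite measurableSet_Iio measurable_const measurable_const
  fun_prop

theorem rpow_sub_rpow_le_mul {a b p : ℝ} (hb : 0 ≤ b) (hab : b ≤ a) (hp : 1 ≤ p) :
    a ^ p - b ^ p ≤ p * a ^ (p - 1) * (a - b) := by
  rcases (hb.trans hab).eq_or_lt with ha | ha
  · obtain rfl : b = a := le_antisymm hab (ha ▸ hb)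
    simp
  have bern := one_add_mul_self_le_rpow_one_add
    (by linarith [div_nonneg hb ha.le] : -1 ≤ b / a - 1) hp
  rw [add_sub_cancel, Real.div_rpow hb ha.le, le_div_iff₀ (Real.rpow_pos_of_pos ha p)] at bern
  have ha' : a ^ p = a ^ (p - 1) * a := by
    rw [← Real.rpow_add_one ha.ne', sub_add_cancel]
  have : (1 + p * (b / a - 1)) * a ^ p = a ^ p - p * a ^ (p - 1) * (a - b) := by
    rw [ha']; field_simp; ring
  linarith

theorem abs_rpow_sub_rpow_le_mul {a b c p : ℝ} (ha : 0 ≤ a) (hb : 0 ≤ b) (hac : a ≤ c)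
    (hbc : b ≤ c) (hp : 1 ≤ p) : |a ^ p - b ^ p| ≤ p * c ^ (p - 1) * |a - b| := by
  wlog hab : b ≤ a generalizing a b
  · rw [abs_sub_comm, abs_sub_comm a]
    exact this hb ha hbc hac (le_of_not_ge hab)
  rw [abs_of_nonneg (sub_nonneg.2 (Real.rpow_le_rpow hb hab (by linarith))),
    abs_of_nonneg (sub_nonneg.2 hab)]
  refine (rpow_sub_rpow_le_mul hb hab hp).trans ?_
  have := Real.rpow_le_rpow ha hac (by linarith : 0 ≤ p - 1)
  have := sub_nonneg.2 hab
  gcongr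

theorem abs_etaLp_sub_le {τ p : ℝ} (hτ : τ ∈ Set.Ioo (0 : ℝ) 1) (hp : 1 ≤ p) (e s : ℝ) :
    |etaLp τ p (e - s) - etaLp τ p e| ≤ p * (|e| + |s|) ^ (p - 1) * |s| := by
  have hp0 : p ≠ 0 := by linarith
  rw [etaLp_eq_posPart_add_negPart hτ hp0, etaLp_eq_posPart_add_negPart hτ hp0]
  have hes : |e - s| ≤ |e| + |s| := abs_sub e s
  have he : |e| ≤ |e| + |s| := by linarith [abs_nonneg s]
  have hc : 0 ≤ p * (|e| + |s|) ^ (p - 1) := by positivity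
  have bound : ∀ x y : ℝ, |x| ≤ |e| + |s| → |y| ≤ |e| + |s| → |x - y| ≤ |s| →
      |max x 0 ^ p - max y 0 ^ p| ≤ p * (|e| + |s|) ^ (p - 1) * |s| := by
    intro x y hx hy hxy
    refine (abs_rpow_sub_rpow_le_mul (le_max_right _ _) (le_max_right _ _)
      (max_le ((le_abs_self x).trans hx) (by positivity))
      (max_le ((le_abs_self y).trans hy) (by positivity)) hp).trans ?_
    exact mul_le_mul_of_nonneg_left ((abs_max_sub_max_le_abs x y 0).trans hxy) hc
  have h₁ := abs_le.1 (bound (e - s) e hes he (by simp))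
  have h₂ := abs_le.1 (bound (-(e - s)) (-e) (by rwa [abs_neg]) (by rwa [abs_neg])
    (by rw [neg_sub, sub_neg_eq_add, sub_add_cancel]))
  obtain ⟨h0, h1⟩ := hτ
  rw [abs_le]
  constructor <;> nlinarith

theorem abs_etaLp_sub_le_of_le {τ p p₀ M : ℝ} (hτ : τ ∈ Set.Ioo (0 : ℝ) 1) (hp : 1 ≤ p)
    (hpp₀ : p ≤ p₀) (hp₀ : p₀ ≤ 2) {s : ℝ} (hs : |s| ≤ M) (e : ℝ) :
    |etaLp τ p (e - s) - etaLp τ p e| ≤ 2 * (1 + (|e| ^ (p₀ - 1) + M ^ (p₀ - 1))) * M := by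
  have hM : 0 ≤ M := (abs_nonneg s).trans hs
  have hpow : (|e| + |s|) ^ (p - 1) ≤ 1 + (|e| ^ (p₀ - 1) + M ^ (p₀ - 1)) := by
    refine (Real.rpow_le_rpow (z := p - 1) (by positivity)
      (add_le_add_right hs |e|) (by linarith)).trans ?_
    rcases le_total (|e| + M) 1 with h | h
    · refine (Real.rpow_le_one (by positivity) h (by linarith)).trans ?_
      linarith [Real.rpow_nonneg (abs_nonneg e) (p₀ - 1), Real.rpow_nonneg hM (p₀ - 1)]
    · refine (Real.rpow_le_rpow_of_exponent_le h (by linarith : p - 1 ≤ p₀ - 1)).trans ?_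
      linarith [Real.rpow_add_le_add_rpow (abs_nonneg e) hM (by linarith : 0 ≤ p₀ - 1)
        (by linarith : p₀ - 1 ≤ 1)]
  refine (abs_etaLp_sub_le hτ hp e s).trans ?_
  have : 0 ≤ (|e| + |s|) ^ (p - 1) := by positivity
  have : p ≤ 2 := hpp₀.trans hp₀
  gcongr

theorem tendsto_integral_etaLp_sub
    {Ω : Type*} [MeasurableSpace Ω] (μ : Measure Ω) [IsFiniteMeasure μ]
    {τ : ℝ} (hτ : τ ∈ Set.Ioo (0 : ℝ) 1) {p₀ : ℝ} (hp₀ : p₀ ≤ 2)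
    {ε : Ω → ℝ} (hεmeas : Measurable ε)
    (hmom : Integrable (fun ω => |ε ω| ^ (p₀ - 1)) μ) (s : ℝ) :
    Tendsto (fun z : ℝ × ℝ => ∫ ω, (etaLp τ z.1 (ε ω - z.2) - etaLp τ z.1 (ε ω)) ∂μ)
      (nhdsWithin 1 (Set.Icc 1 p₀) ×ˢ nhds s)
      (nhds (∫ ω, (etaLp τ 1 (ε ω - s) - etaLp τ 1 (ε ω)) ∂μ)) := by
  refine tendsto_integral_filter_of_dominated_convergence
    (fun ω => 2 * (1 + (|ε ω| ^ (p₀ - 1) + (|s| + 1) ^ (p₀ - 1))) * (|s| + 1)) ?_ ?_ ?_ ?_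
  · refine Eventually.of_forall fun z => Measurable.aestronglyMeasurable ?_
    exact ((measurable_etaLp τ z.1).comp (hεmeas.sub_const _)).sub
      ((measurable_etaLp τ z.1).comp hεmeas)
  · have hnear : ∀ᶠ y in nhds s, |y| < |s| + 1 :=
      continuous_abs.continuousAt.eventually_lt_const (by linarith)
    filter_upwards [prod_mem_prod self_mem_nhdsWithin hnear] with z hz
    exact Eventually.of_forall fun ω =>
      abs_etaLp_sub_le_of_le hτ hz.1.1 hz.1.2 hp₀ (le_of_lt hz.2) (ε ω)
  · exact (((integrable_const 1).add (hmom.add (integrable_const _))).const_mul 2).mul_const _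
  · refine Eventually.of_forall fun ω => ?_
    have hle : nhdsWithin (1 : ℝ) (Set.Icc 1 p₀) ×ˢ nhds s ≤ nhds ((1 : ℝ), s) := by
      rw [nhds_prod_eq]
      exact Filter.prod_mono nhdsWithin_le_nhds le_rfl
    have hsub := tendsto_etaLp_comp hτ one_pos ((continuous_const (y := ε ω)).sub continuous_id) s
    have hconst := tendsto_etaLp_comp hτ one_pos (continuous_const (y := ε ω)) s
    exact (hsub.sub hconst).mono_left hle

theorem tendstoUniformlyOn_of_tendsto_prod_nhds {ι α β : Type*} [TopologicalSpace α]
    [UniformSpace β] {F : ι → α → β} {i₀ : ι} {l l' : Filter ι} {B : Set α} (hB : IsCompact B)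
    (hl : l ≤ l') (hi₀ : pure i₀ ≤ l')
    (hF : ∀ x ∈ B, Tendsto (fun z : ι × α => F z.1 z.2) (l' ×ˢ nhds x) (nhds (F i₀ x))) :
    TendstoUniformlyOn F (F i₀) l B := by
  refine (tendstoLocallyUniformlyOn_iff_tendstoUniformlyOn_of_compact hB).1
    (tendstoLocallyUniformlyOn_iff_forall_tendsto.2 fun x hx => ?_)
  refine Tendsto.mono_right ?_ (nhds_le_uniformity (F i₀ x))
  have hone : Tendsto (fun _ : ι × α => i₀) (l ×ˢ nhdsWithin x B) l' :=
    tendsto_const_pure.mono_right hi₀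
  have hsnd : Tendsto (Prod.snd : ι × α → α) (l ×ˢ nhdsWithin x B) (nhds x) :=
    tendsto_snd.mono_right nhdsWithin_le_nhds
  exact ((hF x hx).comp (hone.prodMk hsnd)).prodMk_nhds
    ((hF x hx).mono_left (Filter.prod_mono hl nhdsWithin_le_nhds))

/-- Pointwise and locally uniform convergence of Q^{lp} to Q as p → 1+. -/
theorem Qlp_tendsto_Q_uniformly_on_compacts
    {Ω : Type*} [MeasurableSpace Ω] (μ : Measure Ω) [IsProbabilityMeasure μ]
    (τ : ℝ) (hτ : τ ∈ Set.Ioo (0 : ℝ) 1)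
    (p₀ : ℝ) (hp₀ : p₀ ∈ Set.Ioc (1 : ℝ) 2)
    (ε : Ω → ℝ) (hεmeas : Measurable ε)
    (hmom : Integrable (fun ω => |ε ω| ^ (p₀ - 1)) μ) :
    (∀ s : ℝ,
      Tendsto (fun p : ℝ => ∫ ω, (etaLp τ p (ε ω - s) - etaLp τ p (ε ω)) ∂μ)
        (nhdsWithin 1 (Set.Ioi 1))
        (nhds (∫ ω, (etaLp τ 1 (ε ω - s) - etaLp τ 1 (ε ω)) ∂μ))) ∧
    ∀ B : Set ℝ, IsCompact B →
      TendstoUniformlyOn (fun (p : ℝ) (s : ℝ) => ∫ ω, (etaLp τ p (ε ω - s) - etaLp τ p (ε ω)) ∂μ)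
        (fun s => ∫ ω, (etaLp τ 1 (ε ω - s) - etaLp τ 1 (ε ω)) ∂μ)
        (nhdsWithin 1 (Set.Ioi 1)) B := by
  have hjoint := tendsto_integral_etaLp_sub μ hτ hp₀.2 hεmeas hmom
  have hright : nhdsWithin (1 : ℝ) (Set.Ioi 1) ≤ nhdsWithin 1 (Set.Icc 1 p₀) :=
    nhdsWithin_le_of_mem (Icc_mem_nhdsGT_of_mem ⟨le_rfl, hp₀.1⟩)
  have hone : pure (1 : ℝ) ≤ nhdsWithin 1 (Set.Icc 1 p₀) :=
    pure_le_nhdsWithin ⟨le_rfl, hp₀.1.le⟩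
  have hunif := fun (B : Set ℝ) (hB : IsCompact B) =>
    tendstoUniformlyOn_of_tendsto_prod_nhds
      (F := fun p s => ∫ ω, (etaLp τ p (ε ω - s) - etaLp τ p (ε ω)) ∂μ)
      hB hright hone fun s _ => hjoint s
  exact ⟨fun s => (hunif {s} isCompact_singleton).tendsto_at (Set.mem_singleton s), hunif⟩
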